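/- Let a∈[0,1] and let (ω,m,Λ) be an admissible frequency triple with Λ>0. Then: (1) dV₀/dr has at most two zeros in [1,∞); (2) if dV₀/dr has no zero in [1,∞), then dV₀/dr<0 on [1,∞) (V₀ is strictly decreasing); (3) if dV₀/dr has exactly one zero r* in [1,∞), then either dV₀/dr≤0 on all of [1,∞) (V₀ strictly decreasing), or dV₀/dr>0 on [1,r*) and dV₀/dr<0 on (r*,∞) (r* is the unique critical point of V₀ and a global maximum of V₀ on [1,∞)); (4) if dV₀/dr has exactly two zeros r_min<r_max in [1,∞), then dV₀/dr<0 on [1,r_min), dV₀/dr>0 on (r_min,r_max) and dV₀/dr<0 on (r_max,∞), so r_min is a local minimum and r_max a local maximum of V₀. (This is the trichotomy of part (i) of Lemma 5.2 for the shape of V₀ on [1,∞).) -/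

import Mathlib

noncomputable section

/-- Normalized (horizon radius `r₊ = 1`) `Δ(r) = (r−1)(r−a²)`. -/
def kDelta (a r : ℝ) : ℝ := (r - 1) * (r - a ^ 2)

/-- `V₀(r) = (r²+a²)⁻²(2ma(1+a²)ωr − a²m² + ΛΔ(r))`. -/
def V0 (a : ℝ) (m : ℤ) (ω Λ r : ℝ) : ℝ :=
  ((r ^ 2 + a ^ 2)⁻¹) ^ 2 *
    (2 * (m : ℝ) * a * (1 + a ^ 2) * ω * r - a ^ 2 * (m : ℝ) ^ 2 + Λ * kDelta a r)

/-- A frequency triple `(ω, m, Λ)` is admissible iff `Λ ≥ max{|m|(|m|+1), 2|mω|}`. -/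
def Admissible (m : ℤ) (ω Λ : ℝ) : Prop :=
  max (|(m : ℝ)| * (|(m : ℝ)| + 1)) (2 * |(m : ℝ) * ω|) ≤ Λ

/-- The set of zeros of `dV₀/dr` in `[1,∞)`. -/
def critSet (a : ℝ) (m : ℤ) (ω Λ : ℝ) : Set ℝ :=
  {r : ℝ | 1 ≤ r ∧ deriv (V0 a m ω Λ) r = 0}

open Set

/-- A quadratic with positive leading coefficient is either positive on `[1, ∞)` or factors over
the reals with its larger root in `[1, ∞)`. -/
theorem quadratic_pos_or_factors {A E F : ℝ} (hA : 0 < A) :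
    (∀ r : ℝ, 1 ≤ r → 0 < A * r ^ 2 + E * r + F) ∨
      ∃ α β : ℝ, α ≤ β ∧ 1 ≤ β ∧ ∀ r : ℝ, A * r ^ 2 + E * r + F = A * ((r - α) * (r - β)) := by
  by_cases h : ∀ r : ℝ, 1 ≤ r → 0 < A * r ^ 2 + E * r + F
  · exact Or.inl h
  right
  push Not at h
  obtain ⟨r₀, hr₀, hq⟩ := h
  have hsq : (2 * A * r₀ + E) ^ 2 ≤ E ^ 2 - 4 * A * F := by
    nlinarith [mul_nonneg hA.le (neg_nonneg.2 hq)]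
  have hdisc : 0 ≤ E ^ 2 - 4 * A * F := (sq_nonneg _).trans hsq
  set d := √(E ^ 2 - 4 * A * F)
  have hd : 0 ≤ d := Real.sqrt_nonneg _
  have hdd : d ^ 2 = E ^ 2 - 4 * A * F := Real.sq_sqrt hdisc
  have hle : 2 * A * r₀ + E ≤ d := Real.le_sqrt_of_sq_le hsq
  refine ⟨(-E - d) / (2 * A), (-E + d) / (2 * A), ?_, ?_, fun r => ?_⟩
  · gcongr
    linarith
  · rw [le_div_iff₀ (by positivity)]
    nlinarith
  · field_simp
    linear_combination hdd

/-- A cubic whose coefficients have the signs of the numerator of `dV₀/dr` has a nonpositive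
root. -/
theorem exists_nonpos_root {L C D b : ℝ} (hL : 0 < L) (hC : 0 ≤ C) (hb : 0 ≤ b) (hb1 : b ≤ 1) :
    ∃ s ≤ 0, -2 * L * s ^ 3 + 3 * C * s ^ 2 + D * s - b * C = 0 := by
  set R := 1 + |D| / (2 * L) with hR
  have hR1 : 1 ≤ R := le_add_of_nonneg_right (by positivity)
  have hRD : D ≤ 2 * L * R := by
    have : 2 * L * R = 2 * L + |D| := by rw [hR]; field_simp
    linarith [le_abs_self D]
  have hcont : ContinuousOn (fun s : ℝ => -2 * L * s ^ 3 + 3 * C * s ^ 2 + D * s - b * C)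
      (Icc (-R) 0) := by fun_prop
  have hmem : (0 : ℝ) ∈ Icc (-2 * L * 0 ^ 3 + 3 * C * 0 ^ 2 + D * 0 - b * C)
      (-2 * L * (-R) ^ 3 + 3 * C * (-R) ^ 2 + D * (-R) - b * C) := by
    constructor
    · nlinarith [mul_nonneg hb hC]
    · have h1 : 0 ≤ R * (2 * L * R ^ 2 - D) := by
        refine mul_nonneg (by linarith) ?_
        nlinarith [mul_nonneg hL.le (mul_nonneg (sub_nonneg.2 hR1) (zero_le_one.trans hR1))]
      have h2 : 0 ≤ C * (3 * R ^ 2 - b) := mul_nonneg hC (by nlinarith)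
      nlinarith
  obtain ⟨s, hs, hs0⟩ := intermediate_value_Icc' (by linarith : -R ≤ 0) hcont hmem
  exact ⟨s, hs.2, hs0⟩

theorem hasDerivAt_V0 (a : ℝ) (m : ℤ) (ω Λ : ℝ) {r : ℝ} (hr : 1 ≤ r) :
    HasDerivAt (V0 a m ω Λ)
      (((r ^ 2 + a ^ 2)⁻¹) ^ 3 *
        (-2 * Λ * r ^ 3 + 3 * ((1 + a ^ 2) * (Λ - 2 * m * a * ω)) * r ^ 2
          + (4 * a ^ 2 * m ^ 2 - 2 * Λ * a ^ 2) * r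
          - a ^ 2 * ((1 + a ^ 2) * (Λ - 2 * m * a * ω)))) r := by
  have hne : r ^ 2 + a ^ 2 ≠ 0 := by positivity
  have hden : HasDerivAt (fun x : ℝ => x ^ 2 + a ^ 2) (2 * r) r := by
    simpa using (hasDerivAt_pow 2 r).add_const (a ^ 2)
  have hΔ : HasDerivAt (kDelta a) (2 * r - 1 - a ^ 2) r := by
    refine (((hasDerivAt_id r).sub_const 1).mul
      ((hasDerivAt_id r).sub_const (a ^ 2))).congr_deriv ?_
    simp only [id]
    ring
  have hnum := (((hasDerivAt_id r).const_mul (2 * (m : ℝ) * a * (1 + a ^ 2) * ω)).sub_const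
    (a ^ 2 * (m : ℝ) ^ 2)).add (hΔ.const_mul Λ)
  refine (((hden.inv hne).pow 2).mul hnum).congr_deriv ?_
  simp only [id, kDelta, Pi.inv_apply, Pi.pow_apply, Pi.add_apply, Nat.reduceSub, pow_one,
    Nat.cast_ofNat]
  field_simp
  ring

/-- The sign structure of `dV₀/dr` on `[1, ∞)` is that of a concave quadratic. -/
theorem deriv_V0_neg_or_factors {a : ℝ} (ha : a ∈ Icc (0 : ℝ) 1) {m : ℤ} {ω Λ : ℝ}
    (hadm : Admissible m ω Λ) (hΛ : 0 < Λ) :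
    (∀ r : ℝ, 1 ≤ r → deriv (V0 a m ω Λ) r < 0) ∨
      ∃ α β : ℝ, α ≤ β ∧ 1 ≤ β ∧ ∀ r : ℝ, 1 ≤ r →
        ∃ w : ℝ, 0 < w ∧ deriv (V0 a m ω Λ) r = -(w * ((r - α) * (r - β))) := by
  obtain ⟨ha0, ha1⟩ := ha
  have hC : 0 ≤ (1 + a ^ 2) * (Λ - 2 * m * a * ω) := by
    have h1 : 2 * |(m : ℝ) * ω| ≤ Λ := (le_max_right _ _).trans hadm
    have h2 := mul_le_of_le_one_left (abs_nonneg ((m : ℝ) * ω)) ha1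
    have h3 := mul_le_mul_of_nonneg_left (le_abs_self ((m : ℝ) * ω)) ha0
    exact mul_nonneg (by positivity) (by linarith)
  set C := (1 + a ^ 2) * (Λ - 2 * m * a * ω)
  set D := 4 * a ^ 2 * (m : ℝ) ^ 2 - 2 * Λ * a ^ 2
  obtain ⟨s, hs, hs0⟩ := exists_nonpos_root (D := D) hΛ hC (sq_nonneg a)
    (pow_le_one₀ ha0 ha1)
  have hderiv (r : ℝ) (hr : 1 ≤ r) : deriv (V0 a m ω Λ) r =
      -(((r ^ 2 + a ^ 2)⁻¹) ^ 3 * (r - s) * (2 * Λ * r ^ 2 + (2 * Λ * s - 3 * C) * r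
        + (2 * Λ * s ^ 2 - 3 * C * s - D))) := by
    rw [(hasDerivAt_V0 a m ω Λ hr).deriv]
    linear_combination (((r ^ 2 + a ^ 2)⁻¹) ^ 3) * hs0
  have hw (r : ℝ) (hr : 1 ≤ r) : 0 < ((r ^ 2 + a ^ 2)⁻¹) ^ 3 * (r - s) := by
    have : 0 < r - s := by linarith
    positivity
  rcases quadratic_pos_or_factors (E := 2 * Λ * s - 3 * C)
    (F := 2 * Λ * s ^ 2 - 3 * C * s - D) (by positivity : 0 < 2 * Λ) with
    h | ⟨α, β, hαβ, hβ, hq⟩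
  · left
    intro r hr
    rw [hderiv r hr]
    exact neg_neg_of_pos (mul_pos (hw r hr) (h r hr))
  · refine Or.inr ⟨α, β, hαβ, hβ, fun r hr =>
      ⟨((r ^ 2 + a ^ 2)⁻¹) ^ 3 * (r - s) * (2 * Λ), mul_pos (hw r hr) (by positivity), ?_⟩⟩
    rw [hderiv r hr, hq r]
    ring

/-- part (i) of Lemma 5.2: the trichotomy for the shape of `V₀` on `[1,∞)`:
(1) `dV₀/dr` has at most two zeros in `[1,∞)`; (2) if it has none, `dV₀/dr < 0` on
`[1,∞)` and `V₀` is strictly decreasing; (3) if it has exactly one zero `r*` then either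
`dV₀/dr ≤ 0` on `[1,∞)` (with `V₀` strictly decreasing) or `dV₀/dr > 0` on `[1,r*)` and
`< 0` on `(r*,∞)` (so `r*` is a global maximum of `V₀` on `[1,∞)`); (4) if it has exactly
two zeros `r_min < r_max` then `dV₀/dr < 0` on `[1,r_min)`, `> 0` on `(r_min,r_max)` and
`< 0` on `(r_max,∞)`, so `r_min` is a local minimum and `r_max` a local maximum. -/
theorem V0_shape_trichotomy (a : ℝ) (ha : a ∈ Set.Icc (0 : ℝ) 1) (m : ℤ) (ω Λ : ℝ)
    (hadm : Admissible m ω Λ) (hΛ : 0 < Λ) :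
    (∀ x ∈ critSet a m ω Λ, ∀ y ∈ critSet a m ω Λ, ∀ z ∈ critSet a m ω Λ,
      x = y ∨ x = z ∨ y = z) ∧
    (critSet a m ω Λ = ∅ →
      (∀ r : ℝ, 1 ≤ r → deriv (V0 a m ω Λ) r < 0) ∧
        StrictAntiOn (V0 a m ω Λ) (Set.Ici 1)) ∧
    (∀ rc : ℝ, critSet a m ω Λ = {rc} →
      ((∀ r : ℝ, 1 ≤ r → deriv (V0 a m ω Λ) r ≤ 0) ∧
          StrictAntiOn (V0 a m ω Λ) (Set.Ici 1)) ∨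
        ((∀ r : ℝ, 1 ≤ r → r < rc → 0 < deriv (V0 a m ω Λ) r) ∧
          (∀ r : ℝ, rc < r → deriv (V0 a m ω Λ) r < 0) ∧
          (∀ r : ℝ, 1 ≤ r → V0 a m ω Λ r ≤ V0 a m ω Λ rc))) ∧
    (∀ rmin rmax : ℝ, rmin < rmax → critSet a m ω Λ = {rmin, rmax} →
      (∀ r : ℝ, 1 ≤ r → r < rmin → deriv (V0 a m ω Λ) r < 0) ∧
      (∀ r : ℝ, rmin < r → r < rmax → 0 < deriv (V0 a m ω Λ) r) ∧
      (∀ r : ℝ, rmax < r → deriv (V0 a m ω Λ) r < 0) ∧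
      IsLocalMinOn (V0 a m ω Λ) (Set.Ici 1) rmin ∧
      IsLocalMaxOn (V0 a m ω Λ) (Set.Ici 1) rmax) := by
  have hcont : ContinuousOn (V0 a m ω Λ) (Ici 1) := fun r hr =>
    (hasDerivAt_V0 a m ω Λ hr).continuousAt.continuousWithinAt
  have hanti_Ici (c : ℝ) (hc : 1 ≤ c) (h : ∀ r, c < r → deriv (V0 a m ω Λ) r < 0) :
      StrictAntiOn (V0 a m ω Λ) (Ici c) :=
    strictAntiOn_of_deriv_neg (convex_Ici c) (hcont.mono (Ici_subset_Ici.2 hc))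
      (fun r hr => h r (by simpa using hr))
  have hanti_Icc (c : ℝ) (h : ∀ r, 1 ≤ r → r < c → deriv (V0 a m ω Λ) r < 0) :
      StrictAntiOn (V0 a m ω Λ) (Icc 1 c) :=
    strictAntiOn_of_deriv_neg (convex_Icc 1 c) (hcont.mono Icc_subset_Ici_self)
      (fun r hr => by rw [interior_Icc] at hr; exact h r hr.1.le hr.2)
  have hmono_Icc (b c : ℝ) (hb : 1 ≤ b) (h : ∀ r, b < r → r < c → 0 < deriv (V0 a m ω Λ) r) :
      StrictMonoOn (V0 a m ω Λ) (Icc b c) :=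
    strictMonoOn_of_deriv_pos (convex_Icc b c)
      (hcont.mono (Icc_subset_Ici_self.trans (Ici_subset_Ici.2 hb)))
      (fun r hr => by rw [interior_Icc] at hr; exact h r hr.1 hr.2)
  rcases deriv_V0_neg_or_factors ha hadm hΛ with hneg | ⟨α, β, hαβ, hβ, hfac⟩
  · have hempty : critSet a m ω Λ = ∅ :=
      eq_empty_of_forall_notMem fun r hr => (hneg r hr.1).ne hr.2
    refine ⟨fun x hx => ?_, fun _ => ⟨hneg, hanti_Ici 1 le_rfl fun r hr => hneg r hr.le⟩,
      fun rc h => ?_, fun rmin rmax _ h => ?_⟩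
    · simp [hempty] at hx
    · exact absurd (hempty.symm.trans h).symm (singleton_ne_empty rc)
    · exact absurd (hempty.symm.trans h).symm (insert_nonempty _ _).ne_empty
  have hmem (r : ℝ) : r ∈ critSet a m ω Λ ↔ 1 ≤ r ∧ (r = α ∨ r = β) := by
    refine and_congr_right fun hr => ?_
    obtain ⟨w, hw, hd⟩ := hfac r hr
    rw [hd, neg_eq_zero, mul_eq_zero_iff_left hw.ne', mul_eq_zero, sub_eq_zero, sub_eq_zero]
  have hβmem : β ∈ critSet a m ω Λ := (hmem β).2 ⟨hβ, Or.inr rfl⟩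
  have hright (r : ℝ) (hr : β < r) : deriv (V0 a m ω Λ) r < 0 := by
    obtain ⟨w, hw, hd⟩ := hfac r (by linarith)
    rw [hd]
    exact neg_neg_of_pos (mul_pos hw (mul_pos (by linarith) (by linarith)))
  have hmiddle (r : ℝ) (hr : 1 ≤ r) (hαr : α < r) (hrβ : r < β) :
      0 < deriv (V0 a m ω Λ) r := by
    obtain ⟨w, hw, hd⟩ := hfac r hr
    rw [hd]
    exact neg_pos_of_neg (mul_neg_of_pos_of_neg hw
      (mul_neg_of_pos_of_neg (by linarith) (by linarith)))
  have hleft (r : ℝ) (hr : 1 ≤ r) (hrα : r < α) : deriv (V0 a m ω Λ) r < 0 := by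
    obtain ⟨w, hw, hd⟩ := hfac r hr
    rw [hd]
    exact neg_neg_of_pos (mul_pos hw (mul_pos_of_neg_of_neg (by linarith) (by linarith)))
  have hantiβ := hanti_Ici β hβ hright
  refine ⟨fun x hx y hy z hz => ?_, fun h => ?_, fun rc h => ?_, fun rmin rmax hlt h => ?_⟩
  · rw [hmem] at hx hy hz
    grind
  · simp [h] at hβmem
  · obtain rfl : β = rc := by simpa [h] using hβmem
    rcases lt_or_ge α 1 with hα | hα
    · right
      have hpos (r : ℝ) (hr : 1 ≤ r) (hrβ : r < β) := hmiddle r hr (by linarith) hrβ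
      refine ⟨hpos, hright, fun r hr => ?_⟩
      rcases le_total r β with hrβ | hrβ
      · exact (hmono_Icc 1 β le_rfl fun r hr => hpos r hr.le).monotoneOn
          ⟨hr, hrβ⟩ ⟨hβ, le_rfl⟩ hrβ
      · exact hantiβ.antitoneOn self_mem_Ici hrβ hrβ
    · left
      have hα_mem : α ∈ critSet a m ω Λ := (hmem α).2 ⟨hα, Or.inl rfl⟩
      obtain rfl : α = β := by simpa [h] using hα_mem
      refine ⟨fun r hr => ?_, ?_⟩
      · rcases lt_trichotomy r α with hrα | rfl | hrα
        · exact (hleft r hr hrα).le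
        · exact hβmem.2.le
        · exact (hright r hrα).le
      · rw [← Icc_union_Ici_eq_Ici hα]
        exact (hanti_Icc α hleft).union hantiβ (isGreatest_Icc hα) isLeast_Ici
  · have hmin := (hmem rmin).1 (h ▸ mem_insert rmin {rmax})
    have hmax := (hmem rmax).1 (h ▸ mem_insert_of_mem rmin rfl)
    obtain ⟨rfl, rfl⟩ : rmin = α ∧ rmax = β := by grind
    have hanti := hanti_Icc rmin hleft
    have hmono := hmono_Icc rmin rmax hmin.1 fun r hr => hmiddle r (hmin.1.trans hr.le) hr
    refine ⟨hleft, fun r hr => hmiddle r (hmin.1.trans hr.le) hr, hright, ?_, ?_⟩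
    · filter_upwards [self_mem_nhdsWithin, mem_nhdsWithin_of_mem_nhds (Iio_mem_nhds hlt)]
        with r hr hrmax
      rcases le_total r rmin with hrmin | hrmin
      · exact hanti.antitoneOn ⟨hr, hrmin⟩ ⟨hmin.1, le_rfl⟩ hrmin
      · exact hmono.monotoneOn ⟨le_rfl, hlt.le⟩ ⟨hrmin, le_of_lt hrmax⟩ hrmin
    · filter_upwards [mem_nhdsWithin_of_mem_nhds (Ioi_mem_nhds hlt)] with r hrmin
      rcases le_total r rmax with hrmax | hrmax
      · exact hmono.monotoneOn ⟨le_of_lt hrmin, hrmax⟩ ⟨hlt.le, le_rfl⟩ hrmax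
      · exact hantiβ.antitoneOn self_mem_Ici hrmax hrmax
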